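/- Let X be a metric space equipped with a Borel probability measure μ that assigns positive measure to every nonempty open set, let (T_t)_{t∈ℝ} be an ergodic measurable measure-preserving flow on (X,μ), and let f : X → ℝ be integrable with ∫_X f dμ = 0. Then for μ-almost every x with f(x) ≠ 0 there exists a sequence t_k → ∞ such that Φ(t_k, x) = 0 and T_{t_k} x → x as k → ∞. -/

import Mathlib

open MeasureTheory Filter Topology
open scoped ENNReal

theorem isCompact_setOf_forall_nat_le (n : ℕ → ℕ) : IsCompact {x : ℕ → ℕ | ∀ i, x i ≤ n i} := by
  have : {x : ℕ → ℕ | ∀ i, x i ≤ n i} = Set.univ.pi fun i => Set.Iic (n i) := by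
    ext x; simp [Pi.le_def]
  rw [this]
  exact isCompact_univ_pi fun i => (Set.finite_Iic (n i)).isCompact

theorem exists_setOf_forall_lt_le_subset_of_isOpen {n : ℕ → ℕ} {V : Set (ℕ → ℕ)} (hV : IsOpen V)
    (h : {x : ℕ → ℕ | ∀ i, x i ≤ n i} ⊆ V) :
    ∃ k, {x : ℕ → ℕ | ∀ i < k, x i ≤ n i} ⊆ V := by
  by_contra! hcon
  simp only [Set.not_subset] at hcon
  choose x hx hxV using hcon
  obtain ⟨y, hy, φ, hφ, hlim⟩ := (isCompact_setOf_forall_nat_le n).tendsto_subseq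
    (x := fun k i => min (x k i) (n i)) fun k i => min_le_right _ _
  have hlim' : Tendsto (x ∘ φ) atTop (𝓝 y) := by
    rw [tendsto_pi_nhds] at hlim ⊢
    intro i
    refine (hlim i).congr' ?_
    filter_upwards [eventually_gt_atTop i] with k hk
    exact min_eq_left (hx (φ k) i (hk.trans_le (hφ.id_le k)))
  obtain ⟨k, hk⟩ := (hlim'.eventually (hV.mem_nhds (h hy))).exists
  exact hxV _ hk

theorem exists_isCompact_lt_measure_range {α : Type*} [TopologicalSpace α] [MeasurableSpace α]
    (ν : Measure α) [ν.OuterRegular] {g : (ℕ → ℕ) → α} (hg : Continuous g) {a : ℝ≥0∞}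
    (ha : a < ν (Set.range g)) :
    ∃ K, IsCompact K ∧ K ⊆ Set.range g ∧ a ≤ ν K := by
  have step : ∀ (k : ℕ) (C : {C : Set (ℕ → ℕ) // a < ν (g '' C)}),
      ∃ m, a < ν (g '' (C.1 ∩ {x | x k ≤ m})) := by
    rintro k ⟨C, hC⟩
    have hU : g '' C = ⋃ m, g '' (C ∩ {x | x k ≤ m}) := by
      rw [← Set.image_iUnion, ← Set.inter_iUnion]
      congr 1
      refine (Set.inter_eq_left.2 fun x _ => Set.mem_iUnion.2 ⟨x k, le_refl (x k)⟩).symm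
    have hmono : Monotone fun m => g '' (C ∩ {x | x k ≤ m}) := fun m m' hm =>
      Set.image_mono (Set.inter_subset_inter_right _ fun x (hx : x k ≤ m) => hx.trans hm)
    rw [hU, hmono.measure_iUnion] at hC
    exact lt_iSup_iff.1 hC
  choose m hm using step
  let C : ℕ → {C : Set (ℕ → ℕ) // a < ν (g '' C)} := fun k =>
    Nat.rec ⟨Set.univ, by rwa [Set.image_univ]⟩ (fun k C => ⟨C.1 ∩ {x | x k ≤ m k C}, hm k C⟩) k
  have hC : ∀ k, (C k).1 = {x | ∀ i < k, x i ≤ m i (C i)} := by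
    intro k
    induction k with
    | zero => simp [C]
    | succ k ih =>
      change (C k).1 ∩ {x | x k ≤ m k (C k)} = _
      rw [ih]
      ext x
      exact Nat.forall_lt_succ_right.symm
  set K := {x : ℕ → ℕ | ∀ i, x i ≤ m i (C i)}
  refine ⟨g '' K, (isCompact_setOf_forall_nat_le _).image hg, Set.image_subset_range _ _, ?_⟩
  by_contra! hlt
  obtain ⟨U, hKU, hU, hUa⟩ := Set.exists_isOpen_lt_of_lt _ _ hlt
  obtain ⟨k, hk⟩ := exists_setOf_forall_lt_le_subset_of_isOpen (hU.preimage hg)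
    (Set.image_subset_iff.1 hKU)
  rw [← hC] at hk
  exact ((C k).2.trans_le (measure_mono (Set.image_subset_iff.2 hk))).not_gt hUa

/-- Analytic sets are universally measurable. -/
theorem MeasureTheory.AnalyticSet.nullMeasurableSet {α : Type*} [TopologicalSpace α] [T2Space α]
    [MeasurableSpace α] [OpensMeasurableSpace α] {s : Set α} (hs : AnalyticSet s)
    (ν : Measure α) [IsFiniteMeasure ν] [ν.OuterRegular] : NullMeasurableSet s ν := by
  rw [AnalyticSet] at hs
  rcases hs with rfl | ⟨g, hg, rfl⟩
  · exact .empty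
  rcases eq_or_ne (ν (Set.range g)) 0 with h0 | h0
  · exact NullMeasurableSet.of_null h0
  obtain ⟨u, -, hu, hlim⟩ := exists_seq_strictMono_tendsto' (pos_iff_ne_zero.2 h0)
  choose K hK hKs hKu using fun k => exists_isCompact_lt_measure_range ν hg (hu k).2
  have hmeas : MeasurableSet (⋃ k, K k) := .iUnion fun k => (hK k).measurableSet
  refine hmeas.nullMeasurableSet.congr (ae_eq_of_subset_of_measure_ge (Set.iUnion_subset hKs) ?_
    hmeas.nullMeasurableSet (measure_ne_top _ _))
  exact le_of_tendsto' hlim fun k => (hKu k).trans (measure_mono (Set.subset_iUnion K k))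

/-- Projection of a measurable set along `ℝ` is null measurable, without completeness of the
base. -/
theorem MeasurableSet.nullMeasurableSet_image_snd {X : Type*} [MetricSpace X]
    [SecondCountableTopology X] [MeasurableSpace X] [BorelSpace X] {E : Set (ℝ × X)}
    (hE : MeasurableSet E) (μ : Measure X) [IsFiniteMeasure μ] :
    NullMeasurableSet (Prod.snd '' E) μ := by
  let Y := UniformSpace.Completion X
  let _ : MeasurableSpace Y := borel Y
  have : BorelSpace Y := ⟨rfl⟩
  have : SecondCountableTopology Y := UniformSpace.secondCountable_of_separable Y
  let i : X → Y := (↑)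
  have hi : IsEmbedding i := UniformSpace.Completion.isUniformEmbedding_coe X |>.isEmbedding
  have hind : IsInducing (Prod.map (id : ℝ → ℝ) i) := IsInducing.id.prodMap hi.isInducing
  rw [(inferInstance : BorelSpace (ℝ × X)).measurable_eq, hind.eq_induced, borel_comap,
    ← (inferInstance : BorelSpace (ℝ × Y)).measurable_eq] at hE
  obtain ⟨E', hE', rfl⟩ := hE
  have himg : Prod.snd '' (Prod.map (id : ℝ → ℝ) i ⁻¹' E') = i ⁻¹' (Prod.snd '' E') := by
    ext x
    simp
  rw [himg]
  have hA : AnalyticSet (Prod.snd '' E') := hE'.analyticSet.image_of_continuous continuous_snd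
  exact (hA.nullMeasurableSet (μ.map i)).preimage
    ⟨hi.continuous.measurable, Measure.AbsolutelyContinuous.rfl⟩

/-- A metric space carrying a finite measure of full support is second countable. -/
theorem secondCountableTopology_of_forall_isOpen_measure_pos {X : Type*} [MetricSpace X]
    [MeasurableSpace X] [OpensMeasurableSpace X] (μ : Measure X) [SFinite μ]
    (hμ : ∀ U : Set X, IsOpen U → U.Nonempty → 0 < μ U) : SecondCountableTopology X := by
  refine Metric.secondCountable_of_almost_dense_set fun ε hε => ?_
  obtain ⟨s, hs⟩ := zorn_subset {s : Set X | s.Pairwise fun x y => ε < dist x y} fun c hc hchain =>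
    ⟨⋃₀ c, (Set.pairwise_sUnion hchain.directedOn).2 fun t ht => hc ht,
      fun t ht => Set.subset_sUnion_of_mem ht⟩
  refine ⟨s, ?_, fun x => ?_⟩
  · have hdisj : Pairwise (Function.onFun Disjoint fun x : s => Metric.ball (x : X) (ε / 2)) := by
      intro x y hxy
      refine Metric.ball_disjoint_ball ?_
      have := hs.prop x.2 y.2 (Subtype.coe_injective.ne hxy)
      linarith
    have := Measure.countable_meas_pos_of_disjoint_iUnion (μ := μ)
      (fun x : s => (Metric.isOpen_ball (x := (x : X)) (ε := ε / 2)).measurableSet) hdisj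
    have hall : {x : s | 0 < μ (Metric.ball (x : X) (ε / 2))} = Set.univ :=
      Set.eq_univ_of_forall fun x => hμ _ Metric.isOpen_ball ⟨x, Metric.mem_ball_self (half_pos hε)⟩
    rw [hall, Set.countable_univ_iff] at this
    exact Set.countable_coe_iff.1 this
  · by_contra! hcon
    have hins : (insert x s).Pairwise fun x y => ε < dist x y :=
      hs.prop.insert fun y hy _ => ⟨hcon y hy, dist_comm x y ▸ hcon y hy⟩
    have := hcon x (hs.le_of_ge hins (Set.subset_insert _ _) (Set.mem_insert _ _))
    rw [dist_self] at this
    exact this.not_gt hε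

/-- A jointly measurable measure-preserving action of `ℝ`. -/
structure IsMeasurePreservingFlow {X : Type*} [MeasurableSpace X] (T : ℝ → X → X)
    (μ : Measure X) : Prop where
  zero : T 0 = id
  add : ∀ s t : ℝ, T (s + t) = T s ∘ T t
  measurePreserving : ∀ t : ℝ, MeasurePreserving (T t) μ μ
  measurable : Measurable fun p : ℝ × X => T p.1 p.2

namespace IsMeasurePreservingFlow

variable {X : Type*} [MeasurableSpace X] {T : ℝ → X → X} {μ : Measure X}

theorem apply_add (h : IsMeasurePreservingFlow T μ) (s t : ℝ) (x : X) :
    T (s + t) x = T s (T t x) := by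
  rw [h.add]; rfl

theorem measurable_swap (h : IsMeasurePreservingFlow T μ) :
    Measurable fun p : X × ℝ => T p.2 p.1 :=
  h.measurable.comp _root_.measurable_swap

theorem measurable_orbit (h : IsMeasurePreservingFlow T μ) (x : X) :
    Measurable fun s => T s x :=
  h.measurable.comp measurable_prodMk_right

theorem map_prod (h : IsMeasurePreservingFlow T μ) [SFinite μ] (ν : Measure ℝ) [SFinite ν] :
    (μ.prod ν).map (fun p => T p.2 p.1) = ν Set.univ • μ := by
  ext s hs
  rw [Measure.map_apply h.measurable_swap hs,
    Measure.prod_apply_symm (h.measurable_swap hs)]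
  have : ∀ t, μ ((fun x => (x, t)) ⁻¹' ((fun p : X × ℝ => T p.2 p.1) ⁻¹' s)) = μ s := fun t =>
    (h.measurePreserving t).measure_preimage hs.nullMeasurableSet
  simp [this, mul_comm]

theorem quasiMeasurePreserving (h : IsMeasurePreservingFlow T μ) [SFinite μ] (ν : Measure ℝ)
    [SFinite ν] : Measure.QuasiMeasurePreserving (fun p => T p.2 p.1) (μ.prod ν) μ :=
  ⟨h.measurable_swap, by
    rw [h.map_prod]
    exact Measure.smul_absolutelyContinuous⟩

theorem lintegral_lintegral_orbit (h : IsMeasurePreservingFlow T μ) [SFinite μ] (ν : Measure ℝ)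
    [SFinite ν] {u : X → ℝ≥0∞} (hu : AEMeasurable u μ) :
    ∫⁻ x, ∫⁻ s, u (T s x) ∂ν ∂μ = ν Set.univ * ∫⁻ x, u x ∂μ := by
  have hu' : AEMeasurable u ((μ.prod ν).map fun p => T p.2 p.1) :=
    hu.mono_ac (h.quasiMeasurePreserving ν).absolutelyContinuous
  rw [lintegral_lintegral (f := fun x s => u (T s x))
    (hu'.comp_measurable h.measurable_swap),
    ← lintegral_map' hu' h.measurable_swap.aemeasurable, h.map_prod, lintegral_smul_measure,
    smul_eq_mul]

theorem ae_ae_orbit (h : IsMeasurePreservingFlow T μ) [SFinite μ] {p : X → Prop}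
    (hp : ∀ᵐ x ∂μ, p x) : ∀ᵐ x ∂μ, ∀ᵐ s : ℝ, p (T s x) :=
  Measure.ae_ae_of_ae_prod ((h.quasiMeasurePreserving volume).ae hp)

theorem measure_eq_zero_of_ae_ae_orbit_notMem (h : IsMeasurePreservingFlow T μ) [SFinite μ]
    {Z : Set X} (hZ : NullMeasurableSet Z μ) (hZ' : ∀ᵐ x ∂μ, ∀ᵐ s : ℝ, T s x ∉ Z) : μ Z = 0 := by
  have key := h.lintegral_lintegral_orbit (volume.restrict (Set.Ioc 0 1))
    ((aemeasurable_indicator_const_iff (1 : ℝ≥0∞)).2 hZ)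
  have h0 : ∫⁻ x, ∫⁻ s in Set.Ioc 0 1, Z.indicator (fun _ => (1 : ℝ≥0∞)) (T s x) ∂volume ∂μ = 0 := by
    rw [← lintegral_zero (μ := μ)]
    refine lintegral_congr_ae ?_
    filter_upwards [hZ'] with x hx
    rw [← lintegral_zero (μ := volume.restrict (Set.Ioc (0 : ℝ) 1))]
    refine lintegral_congr_ae (ae_restrict_of_ae ?_)
    filter_upwards [hx] with s hs
    simp [hs]
  rw [h0, lintegral_indicator_const₀ hZ] at key
  simpa using key.symm

theorem ae_locallyIntegrable (h : IsMeasurePreservingFlow T μ) [SFinite μ] {g : X → ℝ}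
    (hg : Integrable g μ) : ∀ᵐ x ∂μ, LocallyIntegrable fun s => g (T s x) := by
  have : ∀ n : ℕ, ∀ᵐ x ∂μ, IntegrableOn (fun s => g (T s x)) (Set.Icc (-n : ℝ) n) := by
    intro n
    have hint : Integrable g ((μ.prod (volume.restrict (Set.Icc (-n : ℝ) n))).map
        fun p => T p.2 p.1) := by
      rw [h.map_prod]
      exact hg.smul_measure (by simp)
    exact (hint.comp_measurable h.measurable_swap).prod_right_ae
  filter_upwards [ae_all_iff.2 this] with x hx s
  obtain ⟨n, hn⟩ := exists_nat_gt |s|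
  exact ⟨Set.Icc (-n) n, Icc_mem_nhds (abs_lt.1 hn).1 (abs_lt.1 hn).2, hx n⟩

end IsMeasurePreservingFlow

theorem MeasureTheory.LocallyIntegrable.intervalIntegrable {g : ℝ → ℝ} (hg : LocallyIntegrable g)
    (a b : ℝ) : IntervalIntegrable g volume a b :=
  (hg.integrableOn_isCompact isCompact_uIcc).intervalIntegrable

/-- The orbit integrals of `g` are bounded by a constant plus orbit integrals of nonnegative
functions of arbitrarily small mean. -/
def HasSmallOrbitIntegrals {X : Type*} [MeasurableSpace X] (T : ℝ → X → X) (μ : Measure X)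
    (g : X → ℝ) : Prop :=
  ∀ ε : ℝ≥0∞, ε ≠ 0 → ∃ C : ℝ≥0∞, C ≠ ∞ ∧ ∃ e : X → ℝ≥0∞, AEMeasurable e μ ∧ ∫⁻ x, e x ∂μ ≤ ε ∧
    ∀ᵐ x ∂μ, ∀ t : ℝ, 0 ≤ t →
      ‖∫ s in (0 : ℝ)..t, g (T s x)‖ₑ ≤ C + ∫⁻ s in Set.Ioc 0 t, e (T s x)

namespace HasSmallOrbitIntegrals

variable {X : Type*} [MeasurableSpace X] {T : ℝ → X → X} {μ : Measure X}

theorem zero : HasSmallOrbitIntegrals T μ fun _ => 0 :=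
  fun _ _ => ⟨0, by simp, fun _ => 0, aemeasurable_const, by simp, by simp⟩

theorem const_mul {g : X → ℝ} (hs : HasSmallOrbitIntegrals T μ g)
    (c : ℝ) : HasSmallOrbitIntegrals T μ fun x => c * g x := by
  rcases eq_or_ne c 0 with rfl | hc
  · simpa using zero
  intro ε hε
  have hc0 : ‖c‖ₑ ≠ 0 := by simpa using hc
  obtain ⟨C, hC, e, he, heε, hbound⟩ := hs (ε / ‖c‖ₑ) (ENNReal.div_pos hε enorm_ne_top).ne'
  refine ⟨‖c‖ₑ * C, by finiteness, fun x => ‖c‖ₑ * e x, he.const_mul _, ?_, ?_⟩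
  · rw [lintegral_const_mul' _ _ enorm_ne_top, mul_comm]
    exact ENNReal.mul_le_of_le_div heε
  · filter_upwards [hbound] with x hx t ht
    rw [intervalIntegral.integral_const_mul, enorm_mul, lintegral_const_mul' _ _ enorm_ne_top,
      ← mul_add]
    gcongr
    exact hx t ht

theorem indicator_sub_indicator_preimage (h : IsMeasurePreservingFlow T μ) {E : Set X}
    (hE : MeasurableSet E) (r : ℝ) :
    HasSmallOrbitIntegrals T μ fun x =>
      E.indicator (fun _ => (1 : ℝ)) x - (T r ⁻¹' E).indicator (fun _ => 1) x := by
  refine fun ε _ => ⟨ENNReal.ofReal (2 * |r|), by finiteness, fun _ => 0, aemeasurable_const,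
    by simp, .of_forall fun x t _ => ?_⟩
  set φ : ℝ → ℝ := fun s => E.indicator (fun _ => (1 : ℝ)) (T s x)
  have hφ1 : ∀ s, ‖φ s‖ ≤ 1 := fun s => by
    by_cases hs : T s x ∈ E <;> simp [φ, hs]
  have hφ : ∀ a b, IntervalIntegrable φ volume a b := fun a b =>
    (intervalIntegrable_const (c := (1 : ℝ))).mono_fun
      ((measurable_const.indicator hE).comp (h.measurable_orbit x)).aestronglyMeasurable
      (.of_forall fun s => (hφ1 s).trans (by simp))
  have hshift : ∀ s, (T r ⁻¹' E).indicator (fun _ => (1 : ℝ)) (T s x) = φ (r + s) := fun s => by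
    simp only [φ, h.apply_add]
    rfl
  have hφ' : IntervalIntegrable (fun s => φ (r + s)) volume 0 t := by
    simpa using (hφ r (r + t)).comp_add_left r
  have heq : ∫ s in (0 : ℝ)..t, (φ s - (T r ⁻¹' E).indicator (fun _ => 1) (T s x)) =
      (∫ s in (0 : ℝ)..r, φ s) - ∫ s in t..(r + t), φ s := by
    simp_rw [hshift]
    rw [intervalIntegral.integral_sub (hφ _ _) hφ', intervalIntegral.integral_comp_add_left,
      intervalIntegral.integral_interval_sub_interval_comm (hφ _ _) (hφ _ _) (hφ _ _), add_zero]
  have hle := fun a b => intervalIntegral.norm_integral_le_of_norm_le_const (a := a) (b := b)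
    (f := φ) (C := 1) fun s _ => hφ1 s
  rw [heq, lintegral_zero, add_zero, ← ofReal_norm]
  refine ENNReal.ofReal_le_ofReal ((norm_sub_le _ _).trans ?_)
  have h1 := hle 0 r
  have h2 := hle t (r + t)
  rw [sub_zero] at h1
  rw [add_sub_cancel_right] at h2
  linarith

variable [SFinite μ]

theorem of_approx (h : IsMeasurePreservingFlow T μ) {g : X → ℝ} (hg : Integrable g μ)
    (happ : ∀ ε : ℝ≥0∞, ε ≠ 0 → ∃ g' : X → ℝ, Integrable g' μ ∧ HasSmallOrbitIntegrals T μ g' ∧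
      ∫⁻ x, ‖g x - g' x‖ₑ ∂μ ≤ ε) :
    HasSmallOrbitIntegrals T μ g := by
  intro ε hε
  have hε2 : ε / 2 ≠ 0 := (ENNReal.half_pos hε).ne'
  obtain ⟨g', hg', hs, hgg⟩ := happ (ε / 2) hε2
  obtain ⟨C, hC, e, he, heε, hbound⟩ := hs (ε / 2) hε2
  have hd : AEMeasurable (fun x => ‖g x - g' x‖ₑ) μ := (hg.sub hg').aestronglyMeasurable.enorm
  refine ⟨C, hC, fun x => e x + ‖g x - g' x‖ₑ, he.add hd, ?_, ?_⟩
  · rw [lintegral_add_right' _ hd, ← ENNReal.add_halves ε]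
    exact add_le_add heε hgg
  · filter_upwards [hbound, h.ae_locallyIntegrable hg, h.ae_locallyIntegrable hg']
      with x hx hgx hgx' t ht
    have hdx : AEMeasurable (fun s => ‖g (T s x) - g' (T s x)‖ₑ) (volume.restrict (Set.Ioc 0 t)) :=
      (hgx.sub hgx').aestronglyMeasurable.enorm.restrict
    have hsplit : ∫ s in (0 : ℝ)..t, g (T s x) = (∫ s in (0 : ℝ)..t, g' (T s x)) +
        ∫ s in (0 : ℝ)..t, (g (T s x) - g' (T s x)) := by
      rw [intervalIntegral.integral_sub (hgx.intervalIntegrable _ _) (hgx'.intervalIntegrable _ _)]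
      ring
    rw [hsplit, lintegral_add_right' _ hdx, ← add_assoc]
    refine (enorm_add_le _ _).trans (add_le_add (hx t ht) ?_)
    rw [intervalIntegral.integral_of_le ht]
    exact enorm_integral_le_lintegral_enorm _

theorem congr (h : IsMeasurePreservingFlow T μ) {g g' : X → ℝ} (hg' : Integrable g' μ)
    (hs : HasSmallOrbitIntegrals T μ g') (hgg : g =ᵐ[μ] g') : HasSmallOrbitIntegrals T μ g := by
  refine of_approx h (hg'.congr hgg.symm) fun ε _ => ⟨g', hg', hs, ?_⟩
  rw [lintegral_congr_ae (g := fun _ => 0) (by filter_upwards [hgg] with x hx; simp [hx])]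
  simp

theorem add (h : IsMeasurePreservingFlow T μ) {g g' : X → ℝ} (hg : Integrable g μ)
    (hg' : Integrable g' μ) (hs : HasSmallOrbitIntegrals T μ g)
    (hs' : HasSmallOrbitIntegrals T μ g') : HasSmallOrbitIntegrals T μ fun x => g x + g' x := by
  intro ε hε
  have hε2 : ε / 2 ≠ 0 := (ENNReal.half_pos hε).ne'
  obtain ⟨C, hC, e, he, heε, hbound⟩ := hs (ε / 2) hε2
  obtain ⟨C', hC', e', he', heε', hbound'⟩ := hs' (ε / 2) hε2
  refine ⟨C + C', by finiteness, fun x => e x + e' x, he.add he', ?_, ?_⟩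
  · rw [lintegral_add_right' _ he', ← ENNReal.add_halves ε]
    exact add_le_add heε heε'
  · have hq' := Measure.ae_ae_of_ae_prod ((h.quasiMeasurePreserving volume).ae he'.ae_eq_mk)
    filter_upwards [hbound, hbound', h.ae_locallyIntegrable hg, h.ae_locallyIntegrable hg', hq']
      with x hx hx' hgx hgx' hmx t ht
    have hdx : AEMeasurable (fun s => e' (T s x)) (volume.restrict (Set.Ioc 0 t)) :=
      ⟨fun s => he'.mk e' (T s x), he'.measurable_mk.comp (h.measurable_orbit x),
        ae_restrict_of_ae hmx⟩
    rw [intervalIntegral.integral_add (hgx.intervalIntegrable _ _) (hgx'.intervalIntegrable _ _),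
      lintegral_add_right' _ hdx, add_add_add_comm]
    exact (enorm_add_le _ _).trans (add_le_add (hx t ht) (hx' t ht))

end HasSmallOrbitIntegrals

theorem MeasureTheory.L2.integrable {X : Type*} [MeasurableSpace X] {μ : Measure X}
    [IsFiniteMeasure μ] (g : Lp ℝ 2 μ) : Integrable g μ :=
  (Lp.memLp g).integrable one_le_two

theorem IsMeasurePreservingFlow.exists_ae_eq_const {X : Type*} [MeasurableSpace X]
    {T : ℝ → X → X} {μ : Measure X} [IsProbabilityMeasure μ]
    (hTerg : ∀ E : Set X, MeasurableSet E → (∀ t : ℝ, T t ⁻¹' E =ᵐ[μ] E) → μ E = 0 ∨ μ E = 1)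
    {v : X → ℝ} (hv : Measurable v) (hinv : ∀ t, v ∘ T t =ᵐ[μ] v) :
    ∃ c, v =ᵐ[μ] fun _ => c := by
  refine exists_eventuallyEq_const_of_forall_separating MeasurableSet fun U hU => ?_
  rcases hTerg (v ⁻¹' U) (hv hU) fun t => (hinv t).preimage U with h0 | h1
  · exact .inr (measure_eq_zero_iff_ae_notMem.1 h0)
  · exact .inl ((mem_ae_iff_prob_eq_one (hv hU)).2 h1)

namespace HasSmallOrbitIntegrals

variable {X : Type*} [MeasurableSpace X] {T : ℝ → X → X} {μ : Measure X} [IsProbabilityMeasure μ]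

/-- The square-integrable functions with small orbit integrals form a subspace. -/
def submodule (h : IsMeasurePreservingFlow T μ) : Submodule ℝ (Lp ℝ 2 μ) where
  carrier := {g | HasSmallOrbitIntegrals T μ g}
  zero_mem' := congr h (integrable_zero _ _ _) zero (Lp.coeFn_zero _ _ _)
  add_mem' {g g'} hg hg' :=
    congr h ((L2.integrable g).add (L2.integrable g')) (add h (L2.integrable g) (L2.integrable g')
      hg hg') (Lp.coeFn_add g g')
  smul_mem' c g hg :=
    congr h ((L2.integrable g).const_mul c) (hg.const_mul c) (Lp.coeFn_smul c g)

theorem isClosed_submodule (h : IsMeasurePreservingFlow T μ) :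
    IsClosed (submodule h : Set (Lp ℝ 2 μ)) := by
  refine isClosed_of_closure_subset fun g hg => ?_
  refine of_approx h (L2.integrable g) fun ε hε => ?_
  obtain ⟨g', hg', hd⟩ := EMetric.mem_closure_iff.1 hg ε (pos_iff_ne_zero.2 hε)
  refine ⟨g', L2.integrable g', hg', ?_⟩
  calc ∫⁻ x, ‖g x - g' x‖ₑ ∂μ = eLpNorm (⇑g - ⇑g') 1 μ := by
        rw [eLpNorm_one_eq_lintegral_enorm]; rfl
    _ ≤ eLpNorm (⇑g - ⇑g') 2 μ := eLpNorm_le_eLpNorm_of_exponent_le one_le_two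
        ((L2.integrable g).sub (L2.integrable g')).aestronglyMeasurable
    _ ≤ ε := by rw [← Lp.edist_def]; exact hd.le

theorem comp_ae_eq_of_mem_orthogonal (h : IsMeasurePreservingFlow T μ) {v : Lp ℝ 2 μ}
    (hv : v ∈ (submodule h)ᗮ) (r : ℝ) : v ∘ T r =ᵐ[μ] v := by
  have hint := L2.integrable v
  have hcomp : Integrable (v ∘ T r) μ := (h.measurePreserving r).integrable_comp_of_integrable hint
  refine Integrable.ae_eq_of_forall_setIntegral_eq _ _ hcomp hint fun E hE _ => ?_
  have hE' : MeasurableSet (T (-r) ⁻¹' E) := (h.measurePreserving (-r)).measurable hE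
  have hmem : indicatorConstLp 2 hE (measure_ne_top μ E) (1 : ℝ) -
      indicatorConstLp 2 hE' (measure_ne_top μ _) 1 ∈ submodule h := by
    refine congr h ?_ (indicator_sub_indicator_preimage h hE (-r)) ?_
    · exact ((integrable_const 1).indicator hE).sub ((integrable_const 1).indicator hE')
    · exact (Lp.coeFn_sub _ _).trans (indicatorConstLp_coeFn.sub indicatorConstLp_coeFn)
  have h0 := (Submodule.mem_orthogonal _ _).1 hv _ hmem
  rw [inner_sub_left, L2.inner_indicatorConstLp_one, L2.inner_indicatorConstLp_one,
    sub_eq_zero] at h0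
  have hmap := (h.measurePreserving (-r)).map_eq
  have hchange := setIntegral_map (μ := μ) (g := T (-r)) (f := v ∘ T r) hE
    (by rw [hmap]; exact hcomp.aestronglyMeasurable)
    (h.measurePreserving (-r)).measurable.aemeasurable
  rw [hmap] at hchange
  rw [hchange, h0]
  refine setIntegral_congr_fun hE' fun x _ => ?_
  simp [← h.apply_add, h.zero]

theorem of_memLp_two (h : IsMeasurePreservingFlow T μ)
    (hTerg : ∀ E : Set X, MeasurableSet E → (∀ t : ℝ, T t ⁻¹' E =ᵐ[μ] E) → μ E = 0 ∨ μ E = 1)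
    {g : X → ℝ} (hg : MemLp g 2 μ) (hg0 : ∫ x, g x ∂μ = 0) : HasSmallOrbitIntegrals T μ g := by
  have hmem : hg.toLp g ∈ (submodule h)ᗮᗮ := by
    refine (Submodule.mem_orthogonal _ _).2 fun v hv => ?_
    obtain ⟨c, hc⟩ := IsMeasurePreservingFlow.exists_ae_eq_const hTerg
      (Lp.stronglyMeasurable v).measurable (comp_ae_eq_of_mem_orthogonal h hv)
    rw [L2.inner_def, integral_congr_ae (g := fun x => c * g x), integral_const_mul, hg0, mul_zero]
    filter_upwards [hc, hg.coeFn_toLp] with x hx hx'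
    simp [hx, hx', mul_comm]
  rw [Submodule.orthogonal_orthogonal_eq_closure,
    (isClosed_submodule h).submodule_topologicalClosure_eq] at hmem
  exact congr h (L2.integrable _) hmem hg.coeFn_toLp.symm

theorem of_integral_eq_zero (h : IsMeasurePreservingFlow T μ)
    (hTerg : ∀ E : Set X, MeasurableSet E → (∀ t : ℝ, T t ⁻¹' E =ᵐ[μ] E) → μ E = 0 ∨ μ E = 1)
    {f : X → ℝ} (hf : Integrable f μ) (hf0 : ∫ x, f x ∂μ = 0) : HasSmallOrbitIntegrals T μ f := by
  refine of_approx h hf fun ε hε => ?_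
  obtain ⟨s, hs, -⟩ := (memLp_one_iff_integrable.2 hf).exists_simpleFunc_eLpNorm_sub_lt
    ENNReal.one_ne_top (ENNReal.half_pos hε).ne'
  rw [eLpNorm_one_eq_lintegral_enorm] at hs
  have hsint : Integrable s μ := s.integrable_of_isFiniteMeasure
  set c := ∫ x, s x ∂μ
  have hmem : MemLp (fun x => s x - c) 2 μ := (s.memLp_of_isFiniteMeasure 2 μ).sub (memLp_const c)
  refine ⟨fun x => s x - c, hsint.sub (integrable_const c), of_memLp_two h hTerg hmem ?_, ?_⟩
  · rw [integral_sub hsint (integrable_const c)]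
    simp [c]
  have hc : ‖c‖ₑ ≤ ε / 2 := by
    have : ‖c‖ₑ = ‖∫ x, (f - s) x ∂μ‖ₑ := by
      rw [integral_sub' hf hsint, hf0, zero_sub, enorm_neg]
    rw [this]
    exact (enorm_integral_le_lintegral_enorm _).trans hs.le
  calc ∫⁻ x, ‖f x - (s x - c)‖ₑ ∂μ ≤ ∫⁻ x, (‖(f - s) x‖ₑ + ‖c‖ₑ) ∂μ := by
        refine lintegral_mono fun x => ?_
        rw [sub_sub_eq_add_sub, add_sub_right_comm]
        exact enorm_add_le _ _
    _ = ∫⁻ x, ‖(f - s) x‖ₑ ∂μ + ‖c‖ₑ := by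
        rw [lintegral_add_right _ measurable_const]; simp
    _ ≤ ε / 2 + ε / 2 := add_le_add hs.le hc
    _ = ε := ENNReal.add_halves ε

end HasSmallOrbitIntegrals

theorem setLIntegral_enorm_le_of_injOn_integral {g : ℝ → ℝ} (hg : LocallyIntegrable g)
    {S : Set ℝ} (hS : MeasurableSet S) (hinj : Set.InjOn (fun t => ∫ s in (0 : ℝ)..t, g s) S)
    {M : ℝ≥0∞} (hM : ∀ t ∈ S, ‖∫ s in (0 : ℝ)..t, g s‖ₑ ≤ M) :
    ∫⁻ s in S, ‖g s‖ₑ ≤ 2 * M := by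
  set F := fun t => ∫ s in (0 : ℝ)..t, g s
  set Z := toMeasurable volume {t | ¬ HasDerivAt F (g t) t}
  have hZ : volume Z = 0 := by
    rw [measure_toMeasurable, ← ae_iff]
    filter_upwards [(_root_.LocallyIntegrable.ae_hasDerivAt_integral hg)] with t ht using ht 0
  have hderiv : ∀ t ∈ S \ Z, HasDerivWithinAt F (g t) (S \ Z) t := fun t ht => by
    have : HasDerivAt F (g t) t := by
      by_contra hcon
      exact ht.2 (subset_toMeasurable _ _ hcon)
    exact this.hasDerivWithinAt
  have harea := lintegral_image_eq_lintegral_abs_deriv_mul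
    (hS.diff (measurableSet_toMeasurable _ _)) hderiv (hinj.mono Set.sdiff_subset) fun _ => 1
  simp only [mul_one, setLIntegral_one, ← Real.norm_eq_abs, ofReal_norm] at harea
  rw [← setLIntegral_congr (sdiff_null_ae_eq_self hZ), ← harea]
  refine (measure_mono ?_).trans (Real.volume_closedEBall 0 M).le
  rintro _ ⟨t, ht, rfl⟩
  simpa [Metric.mem_closedEBall, edist_zero_right] using hM t ht.1

namespace IsMeasurePreservingFlow

section Cocycle

variable {X : Type*} [MeasurableSpace X] {T : ℝ → X → X} {μ : Measure X}

theorem integral_orbit_sub (h : IsMeasurePreservingFlow T μ) {f : X → ℝ} {x : X}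
    (hx : LocallyIntegrable fun s => f (T s x)) (s t : ℝ) :
    ∫ u in (0 : ℝ)..t - s, f (T u (T s x)) =
      (∫ u in (0 : ℝ)..t, f (T u x)) - ∫ u in (0 : ℝ)..s, f (T u x) := by
  simp_rw [← h.apply_add]
  rw [intervalIntegral.integral_comp_add_right (fun u => f (T u x)), zero_add, sub_add_cancel,
    intervalIntegral.integral_interval_sub_left (hx.intervalIntegrable _ _)
      (hx.intervalIntegrable _ _)]

theorem measurableSet_integral_orbit_eq_zero (h : IsMeasurePreservingFlow T μ) {f : X → ℝ}
    (hf : Measurable f) {S : Set ℝ} (hS : MeasurableSet S) (hpos : S ⊆ Set.Ioi 0) :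
    MeasurableSet {p : ℝ × X | p.1 ∈ S ∧ ∫ s in (0 : ℝ)..p.1, f (T s p.2) = 0} := by
  have hmeas : StronglyMeasurable fun q : (ℝ × X) × ℝ =>
      (Set.Ioc 0 q.1.1).indicator (fun s => f (T s q.1.2)) q.2 := by
    refine Measurable.stronglyMeasurable ?_
    have hset : MeasurableSet {q : (ℝ × X) × ℝ | q.2 ∈ Set.Ioc 0 q.1.1} :=
      (measurableSet_lt measurable_const measurable_snd).inter
        (measurableSet_le measurable_snd measurable_fst.fst)
    exact (hf.comp (h.measurable.comp (measurable_snd.prodMk measurable_fst.snd))).indicator hset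
  have hI := (hmeas.integral_prod_right' (ν := volume)).measurable
  have heq : {p : ℝ × X | p.1 ∈ S ∧ ∫ s in (0 : ℝ)..p.1, f (T s p.2) = 0} =
      {p : ℝ × X | p.1 ∈ S} ∩
        {p | ∫ s, (Set.Ioc 0 p.1).indicator (fun s => f (T s p.2)) s = 0} := by
    ext p
    refine and_congr_right fun hp => ?_
    rw [intervalIntegral.integral_of_le (hpos hp).le, ← integral_indicator measurableSet_Ioc]
    rfl
  rw [heq]
  exact (measurable_fst hS).inter (hI (measurableSet_singleton 0))

end Cocycle

variable {X : Type*} [MetricSpace X] [SecondCountableTopology X] [MeasurableSpace X]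
  [BorelSpace X] {T : ℝ → X → X} {μ : Measure X} [IsProbabilityMeasure μ]

theorem nullMeasurableSet_exists_integral_orbit_eq_zero (h : IsMeasurePreservingFlow T μ)
    {f : X → ℝ} (hf : Measurable f) {S : Set ℝ} (hS : MeasurableSet S) (hpos : S ⊆ Set.Ioi 0)
    {A : Set X} (hA : MeasurableSet A) :
    NullMeasurableSet {x | ∃ t ∈ S, ∫ s in (0 : ℝ)..t, f (T s x) = 0 ∧ T t x ∈ A} μ := by
  convert ((h.measurableSet_integral_orbit_eq_zero hf hS hpos).inter
    (h.measurable hA)).nullMeasurableSet_image_snd μ using 1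
  ext x
  simp [and_assoc]

theorem ae_exists_forall_integral_orbit_ne_zero (h : IsMeasurePreservingFlow T μ)
    {f : X → ℝ} (hf : Measurable f) (hfi : Integrable f μ) :
    ∀ᵐ x ∂μ, f x ≠ 0 → ∃ n : ℕ, ∀ t ∈ Set.Ioo (0 : ℝ) (1 / (n + 1)),
      ∫ s in (0 : ℝ)..t, f (T s x) ≠ 0 := by
  set Z := {x | f x ≠ 0} ∩ ⋂ n : ℕ, {x | ∃ t ∈ Set.Ioo (0 : ℝ) (1 / (n + 1)),
      ∫ s in (0 : ℝ)..t, f (T s x) = 0 ∧ T t x ∈ Set.univ}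
  have hZ : NullMeasurableSet Z μ :=
    (hf (measurableSet_singleton 0).compl).nullMeasurableSet.inter <| .iInter fun n =>
      h.nullMeasurableSet_exists_integral_orbit_eq_zero hf measurableSet_Ioo
        (fun t ht => ht.1) .univ
  have hZ0 : μ Z = 0 := by
    refine h.measure_eq_zero_of_ae_ae_orbit_notMem hZ ?_
    filter_upwards [h.ae_locallyIntegrable hfi] with x hx
    filter_upwards [(_root_.LocallyIntegrable.ae_hasDerivAt_integral hx)] with s hs
    rintro ⟨hne, hret⟩
    have hev := (hs 0).eventually_ne (c := ∫ u in (0 : ℝ)..s, f (T u x)) hne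
    obtain ⟨ε, hε, hball⟩ := Metric.eventually_nhds_iff.1 (eventually_nhdsWithin_iff.1 hev)
    obtain ⟨n, hn⟩ := exists_nat_one_div_lt hε
    obtain ⟨t, ht, h0, -⟩ := Set.mem_iInter.1 hret n
    refine hball (y := s + t) ?_ ?_ ?_
    · rw [Real.dist_eq, add_sub_cancel_left, abs_of_pos ht.1]
      exact ht.2.trans hn
    · simpa using ht.1.ne'
    · have := h.integral_orbit_sub hx s (s + t)
      rw [add_sub_cancel_left, h0] at this
      linarith
  filter_upwards [measure_eq_zero_iff_ae_notMem.1 hZ0] with x hx hne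
  by_contra! hcon
  exact hx ⟨hne, Set.mem_iInter.2 fun n => (hcon n).imp fun t ht => ⟨ht.1, ht.2, trivial⟩⟩

end IsMeasurePreservingFlow

section IntermittentTimes

variable {δ N : ℝ}

theorem sub_mem_of_mem_iUnion_Ico (hδ : 0 < δ) (hN : 0 < N) {K : ℕ} {s t : ℝ}
    (hs : s ∈ ⋃ j ∈ Finset.range K, Set.Ico ((j : ℝ) * (N + δ)) (j * (N + δ) + δ))
    (ht : t ∈ ⋃ j ∈ Finset.range K, Set.Ico ((j : ℝ) * (N + δ)) (j * (N + δ) + δ))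
    (hst : s < t) : t - s ∈ Set.Ioo 0 δ ∪ Set.Ici N := by
  simp only [Set.mem_iUnion, exists_prop] at hs ht
  obtain ⟨i, -, hi, hi'⟩ := hs
  obtain ⟨j, -, hj, hj'⟩ := ht
  rcases lt_trichotomy i j with hij | rfl | hij
  · have hcast : (i : ℝ) + 1 ≤ j := by exact_mod_cast hij
    exact .inr (Set.mem_Ici.2 (by nlinarith))
  · exact .inl ⟨sub_pos.2 hst, by linarith⟩
  · have hcast : (j : ℝ) + 1 ≤ i := by exact_mod_cast hij
    nlinarith

theorem volume_iUnion_Ico (hδ : 0 < δ) (hN : 0 < N) (K : ℕ) :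
    volume (⋃ j ∈ Finset.range K, Set.Ico ((j : ℝ) * (N + δ)) (j * (N + δ) + δ)) =
      K * ENNReal.ofReal δ := by
  rw [measure_biUnion_finset ?_ fun _ _ => measurableSet_Ico]
  · simp
  have key : ∀ i j : ℕ, i < j → Disjoint (Set.Ico ((i : ℝ) * (N + δ)) (i * (N + δ) + δ))
      (Set.Ico ((j : ℝ) * (N + δ)) (j * (N + δ) + δ)) := fun i j hij => by
    have hcast : (i : ℝ) + 1 ≤ j := by exact_mod_cast hij
    refine Set.disjoint_left.2 fun s hs ht => ?_
    have h1 := hs.2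
    have h2 := ht.1
    nlinarith
  intro i _ j _ hij
  rcases hij.lt_or_gt with hij | hij
  · exact key i j hij
  · exact (key j i hij).symm

end IntermittentTimes

namespace IsMeasurePreservingFlow

variable {X : Type*} [MeasurableSpace X] {T : ℝ → X → X} {μ : Measure X}

theorem injOn_integral_orbit (h : IsMeasurePreservingFlow T μ) {f : X → ℝ} {x : X}
    (hx : LocallyIntegrable fun s => f (T s x)) {R J : Set ℝ} {A B : Set X} (hBA : B ⊆ A)
    (hB : ∀ y ∈ B, ∀ t ∈ R, ∫ s in (0 : ℝ)..t, f (T s y) = 0 → T t y ∉ A)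
    (hJ : ∀ s ∈ J, ∀ t ∈ J, s < t → t - s ∈ R) :
    Set.InjOn (fun t => ∫ s in (0 : ℝ)..t, f (T s x)) (J ∩ (fun s => T s x) ⁻¹' B) := by
  have key : ∀ s ∈ J ∩ (fun s => T s x) ⁻¹' B, ∀ t ∈ J ∩ (fun s => T s x) ⁻¹' B, s < t →
      ∫ u in (0 : ℝ)..s, f (T u x) ≠ ∫ u in (0 : ℝ)..t, f (T u x) := by
    intro s hs t ht hst heq
    refine hB _ hs.2 _ (hJ s hs.1 t ht.1 hst) ?_ ?_
    · rw [h.integral_orbit_sub hx, heq, sub_self]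
    · rw [← h.apply_add, sub_add_cancel]
      exact hBA ht.2
  intro s hs t ht heq
  by_contra hne
  rcases lt_or_gt_of_ne hne with hlt | hlt
  · exact key s hs t ht hlt heq
  · exact key t ht s hs hlt heq.symm

theorem natCast_mul_setLIntegral_le (h : IsMeasurePreservingFlow T μ) [IsProbabilityMeasure μ]
    {f : X → ℝ} (hf : Measurable f) (hfi : Integrable f μ) {δ N : ℝ} (hδ : 0 < δ) (hN : 0 < N)
    {A B : Set X} (hBA : B ⊆ A) (hBm : MeasurableSet B)
    (hB : ∀ y ∈ B, ∀ t ∈ Set.Ioo 0 δ ∪ Set.Ici N,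
      ∫ s in (0 : ℝ)..t, f (T s y) = 0 → T t y ∉ A)
    {C : ℝ≥0∞} {e : X → ℝ≥0∞} (he : AEMeasurable e μ)
    (hbound : ∀ᵐ x ∂μ, ∀ t : ℝ, 0 ≤ t →
      ‖∫ s in (0 : ℝ)..t, f (T s x)‖ₑ ≤ C + ∫⁻ s in Set.Ioc 0 t, e (T s x)) (K : ℕ) :
    K * ENNReal.ofReal δ * ∫⁻ x in B, ‖f x‖ₑ ∂μ ≤
      2 * (C + ENNReal.ofReal (K * (N + δ)) * ∫⁻ x, e x ∂μ) := by
  set J := ⋃ j ∈ Finset.range K, Set.Ico ((j : ℝ) * (N + δ)) (j * (N + δ) + δ) with hJdef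
  have hJm : MeasurableSet J := Finset.measurableSet_biUnion _ fun _ _ => measurableSet_Ico
  have hJle : ∀ t ∈ J, 0 ≤ t ∧ t ≤ K * (N + δ) := by
    intro t ht
    simp only [hJdef, Set.mem_iUnion, exists_prop, Finset.mem_range] at ht
    obtain ⟨j, hjK, hj, hj'⟩ := ht
    have hcast : (j : ℝ) + 1 ≤ K := by exact_mod_cast hjK
    exact ⟨le_trans (by positivity) hj, by nlinarith⟩
  have hfib : ∀ᵐ x ∂μ, ∫⁻ s in J, B.indicator (fun y => ‖f y‖ₑ) (T s x) ≤
      2 * (C + ∫⁻ s in Set.Ioc 0 (K * (N + δ)), e (T s x)) := by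
    filter_upwards [hbound, h.ae_locallyIntegrable hfi] with x hx hloc
    have horb : MeasurableSet ((fun s => T s x) ⁻¹' B) := h.measurable_orbit x hBm
    have heq : ∫⁻ s in J, B.indicator (fun y => ‖f y‖ₑ) (T s x) =
        ∫⁻ s in J ∩ (fun s => T s x) ⁻¹' B, ‖f (T s x)‖ₑ := by
      rw [Set.inter_comm, ← setLIntegral_indicator horb]
      rfl
    rw [heq]
    refine setLIntegral_enorm_le_of_injOn_integral hloc (hJm.inter horb)
      (h.injOn_integral_orbit hloc hBA hB fun s hs t ht =>
        sub_mem_of_mem_iUnion_Ico hδ hN hs ht) fun t ht => (hx t (hJle t ht.1).1).trans ?_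
    gcongr
    exact (hJle t ht.1).2
  have hint := lintegral_mono_ae hfib
  rw [h.lintegral_lintegral_orbit _ (hf.enorm.indicator hBm).aemeasurable,
    lintegral_const_mul' _ _ (by simp), lintegral_add_left measurable_const,
    h.lintegral_lintegral_orbit _ he, lintegral_indicator hBm] at hint
  rwa [Measure.restrict_apply_univ, Measure.restrict_apply_univ, Real.volume_Ioc, sub_zero,
    volume_iUnion_Ico hδ hN, lintegral_const, measure_univ, mul_one] at hint

end IsMeasurePreservingFlow

namespace HasSmallOrbitIntegrals

variable {X : Type*} [MeasurableSpace X] {T : ℝ → X → X} {μ : Measure X}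

theorem measure_eq_zero_of_forall_notMem (h : IsMeasurePreservingFlow T μ)
    [IsProbabilityMeasure μ] {f : X → ℝ} (hs : HasSmallOrbitIntegrals T μ f) (hf : Measurable f)
    (hfi : Integrable f μ) {δ N : ℝ} (hδ : 0 < δ) (hN : 0 < N) {A B : Set X} (hBA : B ⊆ A)
    (hBm : MeasurableSet B) (hA0 : ∀ x ∈ A, f x ≠ 0)
    (hB : ∀ y ∈ B, ∀ t ∈ Set.Ioo 0 δ ∪ Set.Ici N,
      ∫ s in (0 : ℝ)..t, f (T s y) = 0 → T t y ∉ A) : μ B = 0 := by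
  set I := ∫⁻ x in B, ‖f x‖ₑ ∂μ with hI
  have hItop : I ≠ ∞ := ((setLIntegral_le_lintegral _ _).trans_lt hfi.2).ne
  have hI0 : I = 0 := by
    by_contra hne
    have hi : 0 < I.toReal := ENNReal.toReal_pos hne hItop
    have hη : 0 < δ * I.toReal / (4 * (N + δ)) := by positivity
    obtain ⟨C, hC, e, he, heε, hbound⟩ := hs _ (ENNReal.ofReal_pos.2 hη).ne'
    obtain ⟨K, hK⟩ := exists_nat_gt (4 * C.toReal / (δ * I.toReal))
    rw [div_lt_iff₀ (by positivity)] at hK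
    have hle := (h.natCast_mul_setLIntegral_le hf hfi hδ hN hBA hBm hB he hbound K).trans
      (by gcongr : _ ≤ 2 * (C + ENNReal.ofReal (K * (N + δ)) *
        ENNReal.ofReal (δ * I.toReal / (4 * (N + δ)))))
    have hreal := ENNReal.toReal_mono (by finiteness) hle
    rw [← hI, ← ENNReal.ofReal_mul (by positivity), ENNReal.toReal_mul, ENNReal.toReal_mul,
      ENNReal.toReal_mul, ENNReal.toReal_add hC (by finiteness), ENNReal.toReal_ofReal hδ.le,
      ENNReal.toReal_ofReal (by positivity)] at hreal
    have hcancel : K * (N + δ) * (δ * I.toReal / (4 * (N + δ))) = K * (δ * I.toReal) / 4 := by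
      field_simp
    rw [hcancel] at hreal
    simp only [ENNReal.toReal_natCast, ENNReal.toReal_ofNat] at hreal
    nlinarith
  rw [hI, lintegral_eq_zero_iff hf.enorm, Filter.EventuallyEq, ae_restrict_iff' hBm] at hI0
  refine measure_eq_zero_iff_ae_notMem.2 ?_
  filter_upwards [hI0] with x hx hxB
  exact hA0 x (hBA hxB) (enorm_eq_zero.1 (hx hxB))

theorem ae_exists_integral_orbit_eq_zero {X : Type*} [MetricSpace X]
    [SecondCountableTopology X] [MeasurableSpace X] [BorelSpace X] {T : ℝ → X → X}
    {μ : Measure X} [IsProbabilityMeasure μ] (h : IsMeasurePreservingFlow T μ) {f : X → ℝ}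
    (hs : HasSmallOrbitIntegrals T μ f) (hf : Measurable f) (hfi : Integrable f μ) {δ N : ℝ}
    (hδ : 0 < δ) (hN : 0 < N) {A : Set X} (hA : MeasurableSet A) (hA0 : ∀ x ∈ A, f x ≠ 0) :
    ∀ᵐ x ∂μ, x ∈ A → ∃ t ∈ Set.Ioo 0 δ ∪ Set.Ici N,
      ∫ s in (0 : ℝ)..t, f (T s x) = 0 ∧ T t x ∈ A := by
  have hret := h.nullMeasurableSet_exists_integral_orbit_eq_zero hf
    (measurableSet_Ioo (a := 0) (b := δ) |>.union (measurableSet_Ici (a := N)))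
    (Set.union_subset (fun t ht => ht.1) fun t ht => hN.trans_le ht) hA
  obtain ⟨B, hBsub, hBm, hBae⟩ :=
    (hA.nullMeasurableSet.diff hret).exists_measurable_subset_ae_eq
  have hB0 : μ B = 0 := hs.measure_eq_zero_of_forall_notMem h hf hfi hδ hN
    (fun x hx => (hBsub hx).1) hBm hA0 fun y hy t ht h0 hmem => (hBsub hy).2 ⟨t, ht, h0, hmem⟩
  rw [measure_congr hBae] at hB0
  filter_upwards [measure_eq_zero_iff_ae_notMem.1 hB0] with x hx hxA
  by_contra hcon
  exact hx ⟨hxA, hcon⟩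

end HasSmallOrbitIntegrals

theorem ae_exists_tendsto_of_measurable {X : Type*} [MetricSpace X]
    [SecondCountableTopology X] [MeasurableSpace X] [BorelSpace X] {T : ℝ → X → X}
    {μ : Measure X} [IsProbabilityMeasure μ] (h : IsMeasurePreservingFlow T μ) {f : X → ℝ}
    (hs : HasSmallOrbitIntegrals T μ f) (hf : Measurable f) (hfi : Integrable f μ) :
    ∀ᵐ x ∂μ, f x ≠ 0 → ∃ t : ℕ → ℝ, Tendsto t atTop atTop ∧
      (∀ k : ℕ, (∫ s in (0 : ℝ)..(t k), f (T s x)) = 0) ∧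
      Tendsto (fun k => T (t k) x) atTop (𝓝 x) := by
  have hret : ∀ᵐ x ∂μ, ∀ U ∈ TopologicalSpace.countableBasis X, ∀ n m : ℕ,
      x ∈ U ∩ {y | f y ≠ 0} →
        ∃ t ∈ Set.Ioo (0 : ℝ) (1 / (n + 1)) ∪ Set.Ici ((m : ℝ) + 1),
          ∫ s in (0 : ℝ)..t, f (T s x) = 0 ∧ T t x ∈ U ∩ {y | f y ≠ 0} := by
    rw [ae_ball_iff (TopologicalSpace.countable_countableBasis X)]
    intro U hU
    rw [ae_all_iff]
    intro n
    rw [ae_all_iff]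
    intro m
    exact hs.ae_exists_integral_orbit_eq_zero h hf hfi (by positivity) (by positivity)
      ((TopologicalSpace.isOpen_of_mem_countableBasis hU).measurableSet.inter
        (hf (measurableSet_singleton 0).compl)) fun x hx => hx.2
  filter_upwards [hret, h.ae_exists_forall_integral_orbit_ne_zero hf hfi] with x hx hx' hne
  obtain ⟨n, hn⟩ := hx' hne
  have hk : ∀ k : ℕ, ∃ t : ℝ, (k : ℝ) ≤ t ∧ ∫ s in (0 : ℝ)..t, f (T s x) = 0 ∧
      dist (T t x) x ≤ 1 / ((k : ℝ) + 1) := by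
    intro k
    obtain ⟨U, hU, hxU, hUball⟩ := (TopologicalSpace.isBasis_countableBasis X).mem_nhds_iff.1
      (Metric.ball_mem_nhds x (Nat.one_div_pos_of_nat (α := ℝ) (n := k)))
    obtain ⟨t, ht, h0, htU, -⟩ := hx U hU n k ⟨hxU, hne⟩
    rcases ht with ht | ht
    · exact (hn t ht h0).elim
    · exact ⟨t, (le_add_of_nonneg_right zero_le_one).trans ht, h0, (hUball htU).le⟩
  choose t ht h0 hdist using hk
  exact ⟨t, tendsto_atTop_mono ht tendsto_natCast_atTop_atTop, h0,
    tendsto_iff_dist_tendsto_zero.2 <| squeeze_zero (fun _ => dist_nonneg) hdist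
      tendsto_one_div_add_atTop_nhds_zero_nat⟩

/-- Corollary: for an ergodic measure-preserving flow on a metric space whose Borel
probability measure gives positive mass to every nonempty open set, and integrable `f`
with zero mean, for a.e. `x` with `f x ≠ 0` there is `t k → ∞` with
`∫_0^{t k} f(T_s x) ds = 0` and `T_{t k} x → x`. -/
theorem integral_zeros_return_to_point
    {X : Type*} [MetricSpace X] [MeasurableSpace X] [BorelSpace X]
    (μ : Measure X) [IsProbabilityMeasure μ]
    (hμpos : ∀ U : Set X, IsOpen U → U.Nonempty → 0 < μ U)
    (T : ℝ → X → X)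
    (hT0 : T 0 = id)
    (hTadd : ∀ s t : ℝ, T (s + t) = T s ∘ T t)
    (hTmp : ∀ t : ℝ, MeasurePreserving (T t) μ μ)
    (hTmeas : Measurable fun p : ℝ × X => T p.1 p.2)
    (hTerg : ∀ E : Set X, MeasurableSet E → (∀ t : ℝ, T t ⁻¹' E =ᵐ[μ] E) →
      μ E = 0 ∨ μ E = 1)
    (f : X → ℝ) (hf : Integrable f μ) (hf0 : ∫ x, f x ∂μ = 0) :
    ∀ᵐ x ∂μ, f x ≠ 0 →
      ∃ t : ℕ → ℝ, Tendsto t atTop atTop ∧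
        (∀ k : ℕ, (∫ s in (0:ℝ)..(t k), f (T s x)) = 0) ∧
        Tendsto (fun k => T (t k) x) atTop (𝓝 x) := by
  have h : IsMeasurePreservingFlow T μ := ⟨hT0, hTadd, hTmp, hTmeas⟩
  have := secondCountableTopology_of_forall_isOpen_measure_pos μ hμpos
  obtain ⟨g, hg, hfg⟩ := hf.aemeasurable
  have hgi : Integrable g μ := hf.congr hfg
  have hg0 : ∫ x, g x ∂μ = 0 := by rw [← integral_congr_ae hfg, hf0]
  filter_upwards [hfg, h.ae_ae_orbit hfg, ae_exists_tendsto_of_measurable h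
    (.of_integral_eq_zero h hTerg hgi hg0) hg hgi] with x hx horb hret hne
  obtain ⟨t, ht, hzero, hlim⟩ := hret (hx ▸ hne)
  exact ⟨t, ht, fun k => (intervalIntegral.integral_congr_ae
    (horb.mono fun s hs _ => hs)).trans (hzero k), hlim⟩
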